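/- arXiv:1902.08145 — 3 statements merged into one kernel-verified Lean document; each statement's English description precedes it below -/
import Mathlib

section
/- Let H be a real Hilbert space, let F, G : H → [0,∞] be proper, lower semicontinuous, convex functionals, and let δ ≥ 0 be such that F(u) − δ ≤ G(u) ≤ F(u) + δ for all u ∈ H. Let τ > 0, v₀ ∈ H, and let v₁^F be the minimizer of u ↦ (1/(2τ))‖u − v₀‖² + F(u) and v₁^G the minimizer of u ↦ (1/(2τ))‖u − v₀‖² + G(u). Then ‖v₁^F − v₁^G‖ ≤ 2√(δτ). -/
open scoped ENNReal

/-- Convexity of a `[0,∞]`-valued functional, with the conventions of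
extended arithmetic (in particular `0 * ∞ = 0`). -/
def EConvexOn {H : Type*} [AddCommGroup H] [Module ℝ H] (F : H → ℝ≥0∞) : Prop :=
  ∀ u v : H, ∀ a b : ℝ, 0 ≤ a → 0 ≤ b → a + b = 1 →
    F (a • u + b • v) ≤ ENNReal.ofReal a * F u + ENNReal.ofReal b * F v

/-- `m` is the proximal point `J_τ^F[u₀]`, i.e. a minimizer of
`u ↦ (1/(2τ))‖u − u₀‖² + F(u)`. -/
def IsProx {H : Type*} [NormedAddCommGroup H] (F : H → ℝ≥0∞) (τ : ℝ) (u₀ m : H) : Prop :=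
  ∀ u : H,
    ENNReal.ofReal ((1 / (2 * τ)) * ‖m - u₀‖ ^ 2) + F m ≤
      ENNReal.ofReal ((1 / (2 * τ)) * ‖u - u₀‖ ^ 2) + F u

/-- A proximal point of a proper functional lies in its effective domain. -/
theorem IsProx.ne_top {H : Type*} [NormedAddCommGroup H] {F : H → ℝ≥0∞} {τ : ℝ} {u₀ m : H}
    (h : IsProx F τ u₀ m) (hF : ∃ u, F u ≠ ∞) : F m ≠ ∞ := by
  obtain ⟨u, hu⟩ := hF
  exact (le_add_self.trans_lt ((h u).trans_lt
    (ENNReal.add_lt_top.2 ⟨ENNReal.ofReal_lt_top, hu.lt_top⟩))).ne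

/-- The defining inequality of a proximal point between real numbers. -/
theorem IsProx.toReal_le {H : Type*} [NormedAddCommGroup H] {F : H → ℝ≥0∞} {τ : ℝ} (hτ : 0 < τ)
    {u₀ m u : H} (h : IsProx F τ u₀ m) (hm : F m ≠ ∞) (hu : F u ≠ ∞) :
    1 / (2 * τ) * ‖m - u₀‖ ^ 2 + (F m).toReal ≤ 1 / (2 * τ) * ‖u - u₀‖ ^ 2 + (F u).toReal := by
  have := h u
  rwa [← ENNReal.ofReal_toReal hm, ← ENNReal.ofReal_toReal hu,
    ← ENNReal.ofReal_add (by positivity) ENNReal.toReal_nonneg,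
    ← ENNReal.ofReal_add (by positivity) ENNReal.toReal_nonneg,
    ENNReal.ofReal_le_ofReal_iff (by positivity)] at this

/-- A convex functional at a midpoint is at most the average of its values at the endpoints. -/
theorem EConvexOn.midpoint_le {H : Type*} [AddCommGroup H] [Module ℝ H] {F : H → ℝ≥0∞}
    (hF : EConvexOn F) {u v : H} (hu : F u ≠ ∞) (hv : F v ≠ ∞) :
    F (midpoint ℝ u v) ≤ ENNReal.ofReal (((F u).toReal + (F v).toReal) / 2) := by
  have h := hF u v (1 / 2) (1 / 2) (by norm_num) (by norm_num) (by norm_num)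
  rw [← ENNReal.ofReal_toReal hu, ← ENNReal.ofReal_toReal hv,
    ← ENNReal.ofReal_mul (by norm_num), ← ENNReal.ofReal_mul (by norm_num),
    ← ENNReal.ofReal_add (by positivity) (by positivity)] at h
  convert h using 2
  · rw [midpoint_eq_smul_add, smul_add, invOf_eq_inv, one_div]
  · ring

/-- The energy `u ↦ (1/(2τ))‖u − u₀‖² + F(u)` of a convex functional grows at least quadratically
away from the proximal point. -/
theorem IsProx.quadratic_growth {H : Type*} [NormedAddCommGroup H] [InnerProductSpace ℝ H]
    {F : H → ℝ≥0∞} (hF : EConvexOn F) {τ : ℝ} (hτ : 0 < τ) {u₀ m u : H} (h : IsProx F τ u₀ m)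
    (hm : F m ≠ ∞) (hu : F u ≠ ∞) :
    1 / (2 * τ) * ‖m - u₀‖ ^ 2 + (F m).toReal + 1 / (4 * τ) * ‖m - u‖ ^ 2 ≤
      1 / (2 * τ) * ‖u - u₀‖ ^ 2 + (F u).toReal := by
  have hmid := hF.midpoint_le hm hu
  have hmin := h.toReal_le hτ hm (hmid.trans_lt ENNReal.ofReal_lt_top).ne
  have hmid' := ENNReal.toReal_le_of_le_ofReal (by positivity) hmid
  have hpar := parallelogram_law_with_norm ℝ (m - u₀) (u - u₀)
  have hsum : m - u₀ + (u - u₀) = (2 : ℝ) • (midpoint ℝ m u - u₀) := by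
    rw [midpoint_eq_smul_add, invOf_eq_inv]
    module
  rw [hsum, norm_smul, sub_sub_sub_cancel_right, Real.norm_ofNat] at hpar
  have hnorm : ‖midpoint ℝ m u - u₀‖ ^ 2 =
      (‖m - u₀‖ ^ 2 + ‖u - u₀‖ ^ 2) / 2 - ‖m - u‖ ^ 2 / 4 := by
    linarith
  rw [hnorm] at hmin
  have hτ' : 1 / (4 * τ) = 1 / (2 * τ) / 2 := by ring
  rw [hτ']
  linarith

/-- If `F(u) − δ ≤ G(u) ≤ F(u) + δ` for all `u` (in the extended reals), then the proximal
points of `F` and `G` from the same initial point `v₀` satisfy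
`‖v₁^F − v₁^G‖ ≤ 2√(δτ)`. -/
theorem prox_stability {H : Type*} [NormedAddCommGroup H] [InnerProductSpace ℝ H]
    [CompleteSpace H]
    (F G : H → ℝ≥0∞) (hFproper : ∃ u, F u ≠ ∞) (hGproper : ∃ u, G u ≠ ∞)
    (hFlsc : LowerSemicontinuous F) (hGlsc : LowerSemicontinuous G)
    (hFconv : EConvexOn F) (hGconv : EConvexOn G)
    (δ : ℝ) (hδ : 0 ≤ δ)
    (hFG : ∀ u : H, F u ≤ G u + ENNReal.ofReal δ ∧ G u ≤ F u + ENNReal.ofReal δ)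
    (τ : ℝ) (hτ : 0 < τ) (v₀ : H) (v₁F v₁G : H)
    (hv₁F : IsProx F τ v₀ v₁F) (hv₁G : IsProx G τ v₀ v₁G) :
    ‖v₁F - v₁G‖ ≤ 2 * Real.sqrt (δ * τ) := by
  have hF := hv₁F.ne_top hFproper
  have hG := hv₁G.ne_top hGproper
  have hFG_ne : F v₁G ≠ ∞ :=
    ((hFG v₁G).1.trans_lt (ENNReal.add_lt_top.2 ⟨hG.lt_top, ENNReal.ofReal_lt_top⟩)).ne
  have hGF_ne : G v₁F ≠ ∞ :=
    ((hFG v₁F).2.trans_lt (ENNReal.add_lt_top.2 ⟨hF.lt_top, ENNReal.ofReal_lt_top⟩)).ne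
  have hF_growth := hv₁F.quadratic_growth hFconv hτ hF hFG_ne
  have hG_growth := hv₁G.quadratic_growth hGconv hτ hG hGF_ne
  have hF_le : (F v₁G).toReal ≤ (G v₁G).toReal + δ := by
    simpa [ENNReal.toReal_add hG, hδ] using
      ENNReal.toReal_mono (ENNReal.add_ne_top.2 ⟨hG, ENNReal.ofReal_ne_top⟩) (hFG v₁G).1
  have hG_le : (G v₁F).toReal ≤ (F v₁F).toReal + δ := by
    simpa [ENNReal.toReal_add hF, hδ] using
      ENNReal.toReal_mono (ENNReal.add_ne_top.2 ⟨hF, ENNReal.ofReal_ne_top⟩) (hFG v₁F).2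
  rw [norm_sub_rev v₁G v₁F] at hG_growth
  have hdist : ‖v₁F - v₁G‖ ^ 2 / (4 * τ) ≤ δ := by
    rw [div_eq_mul_one_div, mul_comm]
    linarith
  rw [div_le_iff₀ (by positivity)] at hdist
  refine (sq_le_sq₀ (norm_nonneg _) (by positivity)).1 ?_
  rw [mul_pow, Real.sq_sqrt (by positivity)]
  linarith
end

section
/- Let H be a real Hilbert space and let δ, E, M > 0. Let u, v : [0,∞) → H be curves with u(0) = u₀, v(0) = v₀ satisfying: (i) shift non-expansiveness: ‖u(t+s) − u(t)‖ ≤ ‖u(s) − u₀‖ and ‖v(t+s) − v(t)‖ ≤ ‖v(s) − v₀‖ for all s, t ≥ 0; (ii) the energy estimates ‖u(s) − u₀‖ ≤ √(2 s E) and ‖v(s) − v₀‖ ≤ √(2 s E) for all s > 0; (iii) for every s > 0 and every t ≥ 0: if t ≤ δ s²/M² then ‖u(t+s) − v(t+s)‖ ≤ 4√(δ t) + ‖u(s) − v(s)‖, and if t > δ s²/M² then ‖u(t+s) − v(t+s)‖ ≤ 8 (M/s)^{1/3} δ^{1/3} t^{2/3} + ‖u(s) − v(s)‖. Then for all t with 0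 < t ≤ M² E² / δ³ one has ‖u(t) − v(t)‖ ≤ 16 (M E δ t²)^{1/5} + ‖u₀ − v₀‖. -/
/-- If two curves move by at most `R` between times `0` and `s` and between times `t` and `t + s`,
then a comparison bound from time `s` to time `t + s` transfers to times `0` and `t`. -/
theorem norm_sub_le_of_shift_bounds {H : Type*} [NormedAddCommGroup H] {u v : ℝ → H}
    {u₀ v₀ : H} {s t R X : ℝ} (hut : ‖u (t + s) - u t‖ ≤ R) (hvt : ‖v (t + s) - v t‖ ≤ R)
    (hus : ‖u s - u₀‖ ≤ R) (hvs : ‖v s - v₀‖ ≤ R)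
    (hX : ‖u (t + s) - v (t + s)‖ ≤ X + ‖u s - v s‖) :
    ‖u t - v t‖ ≤ 4 * R + X + ‖u₀ - v₀‖ := by
  have h₁ : ‖u t - v t‖ ≤
      ‖u (t + s) - u t‖ + ‖u (t + s) - v (t + s)‖ + ‖v (t + s) - v t‖ := by
    calc ‖u t - v t‖
        = ‖-(u (t + s) - u t) + (u (t + s) - v (t + s)) + (v (t + s) - v t)‖ := by
          congr 1; abel
      _ ≤ _ := by
        simpa only [norm_neg] using
          norm_add₃_le (a := -(u (t + s) - u t)) (b := u (t + s) - v (t + s))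
            (c := v (t + s) - v t)
  have h₂ : ‖u s - v s‖ ≤ ‖u s - u₀‖ + ‖u₀ - v₀‖ + ‖v s - v₀‖ := by
    calc ‖u s - v s‖ = ‖(u s - u₀) + (u₀ - v₀) + -(v s - v₀)‖ := by
          congr 1; abel
      _ ≤ _ := by
        simpa only [norm_neg] using
          norm_add₃_le (a := u s - u₀) (b := u₀ - v₀) (c := -(v s - v₀))
  linarith

/-- Quantitative stability estimate between two gradient-flow-type curves: if the curves
satisfy the shift non-expansiveness property, the energy (evolution variational
inequality) estimates with energy bound `E`, and the shifted two-curve comparison bounds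
with constants `δ` and `M`, then
`‖u(t) − v(t)‖ ≤ 16 (M E δ t²)^{1/5} + ‖u₀ − v₀‖` for all `0 < t ≤ M²E²/δ³`. -/
theorem gradient_flow_stability {H : Type*} [NormedAddCommGroup H] [InnerProductSpace ℝ H]
    [CompleteSpace H]
    (δ E M : ℝ) (hδ : 0 < δ) (hE : 0 < E) (hM : 0 < M)
    (u v : ℝ → H) (u₀ v₀ : H) (hu0 : u 0 = u₀) (hv0 : v 0 = v₀)
    (hshift : ∀ s t : ℝ, 0 ≤ s → 0 ≤ t →
      ‖u (t + s) - u t‖ ≤ ‖u s - u₀‖ ∧ ‖v (t + s) - v t‖ ≤ ‖v s - v₀‖)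
    (henergy : ∀ s : ℝ, 0 < s →
      ‖u s - u₀‖ ≤ Real.sqrt (2 * s * E) ∧ ‖v s - v₀‖ ≤ Real.sqrt (2 * s * E))
    (hcomp : ∀ s : ℝ, 0 < s → ∀ t : ℝ, 0 ≤ t →
      (t ≤ δ * s ^ 2 / M ^ 2 →
        ‖u (t + s) - v (t + s)‖ ≤ 4 * Real.sqrt (δ * t) + ‖u s - v s‖) ∧
      (δ * s ^ 2 / M ^ 2 < t →
        ‖u (t + s) - v (t + s)‖ ≤
          8 * (M / s) ^ ((1 : ℝ) / 3) * δ ^ ((1 : ℝ) / 3) * t ^ ((2 : ℝ) / 3) +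
            ‖u s - v s‖)) :
    ∀ t : ℝ, 0 < t → t ≤ M ^ 2 * E ^ 2 / δ ^ 3 →
      ‖u t - v t‖ ≤ 16 * (M * E * δ * t ^ 2) ^ ((1 : ℝ) / 5) + ‖u₀ - v₀‖ := by
  intro t ht htle
  set A : ℝ := (M * E * δ * t ^ 2) ^ ((1 : ℝ) / 5) with hA
  have hA0 : 0 < A := by positivity
  have hA5 : A ^ 5 = M * E * δ * t ^ 2 := by
    rw [hA, ← Real.rpow_natCast, ← Real.rpow_mul (by positivity)]
    norm_num
  set s : ℝ := A ^ 2 / E with hs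
  have hs0 : 0 < s := by positivity
  have hR : √(2 * s * E) ≤ 3 / 2 * A := by
    rw [hs, show 2 * (A ^ 2 / E) * E = 2 * A ^ 2 by field_simp]
    exact Real.sqrt_le_iff.mpr ⟨by positivity, by nlinarith [sq_nonneg A]⟩
  obtain ⟨hus, hvs⟩ := henergy s hs0
  obtain ⟨hut, hvt⟩ := hshift s t hs0.le ht.le
  have hX : ‖u (t + s) - v (t + s)‖ ≤ 8 * A + ‖u s - v s‖ := by
    rcases le_or_gt t (δ * s ^ 2 / M ^ 2) with h | h
    · have hδt : √(δ * t) ≤ A := by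
        refine Real.sqrt_le_iff.mpr ⟨hA0.le, le_of_pow_le_pow_left₀ (n := 5) (by norm_num)
          (by positivity) ?_⟩
        rw [le_div_iff₀ (by positivity)] at htle
        calc (δ * t) ^ 5 = (t * δ ^ 3) * (δ ^ 2 * t ^ 4) := by ring
          _ ≤ (M ^ 2 * E ^ 2) * (δ ^ 2 * t ^ 4) := by gcongr
          _ = (A ^ 5) ^ 2 := by rw [hA5]; ring
          _ = (A ^ 2) ^ 5 := by ring
      linarith [(hcomp s hs0 t ht.le).1 h]
    · have key : (M / s) ^ ((1 : ℝ) / 3) * δ ^ ((1 : ℝ) / 3) * t ^ ((2 : ℝ) / 3) = A := by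
        have ht2 : t ^ ((2 : ℝ) / 3) = (t ^ 2) ^ ((1 : ℝ) / 3) := by
          rw [← Real.rpow_natCast, ← Real.rpow_mul ht.le]
          norm_num
        have hA3 : M / s * δ * t ^ 2 = A ^ 3 := by
          rw [hs]
          field_simp
          linarith
        rw [ht2, ← Real.mul_rpow (by positivity) (by positivity),
          ← Real.mul_rpow (by positivity) (by positivity), hA3, ← Real.rpow_natCast,
          ← Real.rpow_mul hA0.le]
        norm_num
      linarith [(hcomp s hs0 t ht.le).2 h]
  have hmain := norm_sub_le_of_shift_bounds ((hut.trans hus).trans hR) ((hvt.trans hvs).trans hR)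
    (hus.trans hR) (hvs.trans hR) hX
  linarith
end

section
/- Let L, δ, t be positive real numbers with t > δ/L², and set n := ⌈ L^{2/3} (t/δ)^{1/3} ⌉. Then n ≥ 2 and √2 · L t / n + 2 n √(δ t / n) ≤ 8 (L δ t²)^{1/3}. -/
/-- For `t > δ/L²` and `n = ⌈L^{2/3}(t/δ)^{1/3}⌉`, one has `n ≥ 2` and
`√2·Lt/n + 2n√(δt/n) ≤ 8(Lδt²)^{1/3}`. -/
theorem ceil_choice_estimate (L δ t : ℝ) (hL : 0 < L) (hδ : 0 < δ) (ht : 0 < t)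
    (h : δ / L ^ 2 < t) (n : ℕ)
    (hn : n = ⌈L ^ ((2 : ℝ) / 3) * (t / δ) ^ ((1 : ℝ) / 3)⌉₊) :
    2 ≤ n ∧
      Real.sqrt 2 * L * t / n + 2 * n * Real.sqrt (δ * t / n) ≤
        8 * (L * δ * t ^ 2) ^ ((1 : ℝ) / 3) := by
  set x : ℝ := L ^ ((2 : ℝ) / 3) * (t / δ) ^ ((1 : ℝ) / 3) with hx
  set R : ℝ := (L * δ * t ^ 2) ^ ((1 : ℝ) / 3) with hR
  have hx0 : 0 < x := by positivity
  have hR0 : 0 < R := by positivity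
  have hx3 : x ^ 3 = L ^ 2 * (t / δ) := by
    rw [hx, mul_pow, ← Real.rpow_natCast, ← Real.rpow_natCast, ← Real.rpow_mul hL.le,
      ← Real.rpow_mul (by positivity)]
    norm_num
  have hR3 : R ^ 3 = L * δ * t ^ 2 := by
    rw [hR, ← Real.rpow_natCast, ← Real.rpow_mul (by positivity)]
    norm_num
  have hx1 : 1 < x := by
    have h3 : 1 < x ^ 3 := by
      rw [div_lt_iff₀ (by positivity)] at h
      rw [hx3, ← mul_div_assoc, lt_div_iff₀ hδ]
      linarith
    exact (one_lt_pow_iff_of_nonneg hx0.le three_ne_zero).mp h3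
  have hLt : L * t = R * x := by
    refine (pow_left_inj₀ (by positivity) (by positivity) three_ne_zero).mp ?_
    rw [mul_pow R, hx3, hR3]
    field_simp
  have hδt : δ * t = R ^ 2 / x := by
    rw [eq_div_iff hx0.ne']
    refine mul_right_cancel₀ (pow_ne_zero 2 hx0.ne') ?_
    rw [← mul_pow, ← hLt, mul_assoc, ← pow_succ', hx3]
    field_simp
  have hxn : x ≤ n := hn ▸ Nat.le_ceil x
  have hnx : (n : ℝ) ≤ 2 * x := by
    have := Nat.ceil_lt_add_one hx0.le
    rw [← hn] at this
    linarith
  have hn0 : (0 : ℝ) < n := hx0.trans_le hxn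
  refine ⟨by exact_mod_cast hx1.trans_le hxn, ?_⟩
  have hsqrt2 : √2 ≤ 3 / 2 := by
    rw [Real.sqrt_le_left (by norm_num)]
    norm_num
  have h₁ : √2 * L * t / n ≤ 3 / 2 * R := by
    rw [div_le_iff₀ hn0, mul_assoc, hLt, mul_assoc]
    gcongr
  have h₂ : √(δ * t / n) ≤ 3 / 2 * R / n := by
    rw [Real.sqrt_le_left (by positivity), hδt, div_div, div_pow,
      div_le_div_iff₀ (by positivity) (by positivity)]
    calc R ^ 2 * (n : ℝ) ^ 2 = R ^ 2 * n * n := by ring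
      _ ≤ R ^ 2 * n * (2 * x) := by gcongr
      _ ≤ (3 / 2 * R) ^ 2 * (x * n) := by
        have : 0 < R ^ 2 * (x * n) := by positivity
        linarith
  have h₃ : 2 * n * √(δ * t / n) ≤ 3 * R := by
    calc 2 * n * √(δ * t / n) ≤ 2 * n * (3 / 2 * R / n) := by gcongr
      _ = 3 * R := by field_simp
  linarith
end
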